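/- (Sawada–Williams, sigma–tau Hamiltonian path) For every n ≥ 2, there exists an ordering π₁, π₂, …, π_{n!} of all elements of the symmetric group Sₙ, with no repetitions, such that for every k with 1 ≤ k < n! either π_{k+1} = π_k·σ or π_{k+1} = π_k·τ, where σ is the n-cycle (1 2 … n) and τ is the transposition (1 2); that is, the directed Cayley graph of Sₙ with generators σ and τ has a Hamiltonian path. -/

import Mathlib

namespace SigTau
open List

/-- the rule telling which words take the tau edge -/
def T {m : ℕ} (w : List (Option (ZMod m))) : Prop :=
  ∃ a l r v, w = a :: some (r + 1) :: l ∧ (a :: l) ~r (none :: some r :: v)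

inductive Step {m : ℕ} : List (Option (ZMod m)) → List (Option (ZMod m)) → Prop
  | sig (w) : ¬ T w → Step w (w.rotate 1)
  | tau (a b l) : T (a :: b :: l) → Step (a :: b :: l) (b :: a :: l)

def E {m : ℕ} (u v : List (Option (ZMod m))) : Prop := Relation.EqvGen Step u v

theorem E.trans {m : ℕ} {u v w : List (Option (ZMod m))} (h : E u v) (h' : E v w) : E u w :=
  Relation.EqvGen.trans _ _ _ h h'
theorem E.symm {m : ℕ} {u v : List (Option (ZMod m))} (h : E u v) : E v u :=
  Relation.EqvGen.symm _ _ h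
theorem E.refl {m : ℕ} (u : List (Option (ZMod m))) : E u u := Relation.EqvGen.refl _
theorem E.sig {m : ℕ} {u : List (Option (ZMod m))} (h : ¬ T u) : E u (u.rotate 1) :=
  Relation.EqvGen.rel _ _ (Step.sig _ h)
theorem E.tau {m : ℕ} {a b} {l : List (Option (ZMod m))} (h : T (a :: b :: l)) :
    E (a :: b :: l) (b :: a :: l) :=
  Relation.EqvGen.rel _ _ (Step.tau _ _ _ h)

def Word {m : ℕ} (w : List (Option (ZMod m))) : Prop := w.Nodup ∧ w.length = m + 1

theorem Word.rot {m : ℕ} {u v : List (Option (ZMod m))} (h : Word u) (hr : v ~r u) : Word v :=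
  ⟨hr.nodup_iff.2 h.1, by rw [hr.perm.length_eq]; exact h.2⟩

theorem Word.mem {m : ℕ} [NeZero m] {u : List (Option (ZMod m))} (h : Word u) (x) : x ∈ u := by
  have h1 : u.toFinset.card = Fintype.card (Option (ZMod m)) := by
    rw [List.toFinset_card_of_nodup h.1, h.2, Fintype.card_option, ZMod.card]
  have h2 := (Finset.card_eq_iff_eq_univ _).1 h1
  rw [← List.mem_toFinset, h2]; simp

theorem rot_split {α : Type*} {u v : List α} (h : u ~r v) : ∃ p q, u = p ++ q ∧ v = q ++ p := by
  obtain ⟨k, hk, rfl⟩ := isRotated_iff_mod.1 h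
  exact ⟨u.take k, u.drop k, by simp, rotate_eq_drop_append_take hk⟩

theorem rot_head {α : Type*} {x : α} {A B : List α} (hn : (x :: A).Nodup)
    (h : (x :: A) ~r (x :: B)) : A = B := by
  obtain ⟨p, q, h1, h2⟩ := rot_split h
  cases p with
  | nil =>
    simp only [nil_append, append_nil] at h1 h2
    have := h1.trans h2.symm
    simpa using this
  | cons a p =>
    cases q with
    | nil => simp_all
    | cons b q =>
      simp only [cons_append, cons.injEq] at h1 h2
      obtain ⟨rfl, rfl⟩ := h1
      obtain ⟨rfl, rfl⟩ := h2
      simp at hn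

theorem rot1 {α : Type*} (a : α) (l : List α) : (a :: l).rotate 1 = l ++ [a] := by simp

theorem T_cases {m : ℕ} {v A : List (Option (ZMod m))} {r : ZMod m}
    (hn : (none :: some r :: A).Nodup) (hv : v ~r (none :: some r :: A)) (hT : T v) :
    (∃ r' A', r = r' + 1 ∧ A = some r' :: A' ∧ v = none :: some r :: A) ∨
    (∃ A1 A2, A = A1 ++ some (r + 1) :: A2 ∧
      v.rotate 1 = some (r + 1) :: A2 ++ none :: some r :: A1) := by
  obtain ⟨a, l, s, v', rfl, h⟩ := hT
  have hn' := hv.nodup_iff.2 hn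
  have hn2 : (a :: l).Nodup := by
    simp only [nodup_cons, mem_cons, not_or] at hn' ⊢; tauto
  obtain ⟨p, q, h1, h2⟩ := rot_split h
  cases p with
  | nil =>
    simp only [nil_append, append_nil] at h1 h2
    subst h1
    simp only [cons.injEq] at h2
    obtain ⟨rfl, rfl⟩ := h2
    left
    have := rot_head hn' hv
    simp only [cons.injEq, Option.some.injEq] at this
    obtain ⟨rfl, rfl⟩ := this
    exact ⟨s, v', rfl, rfl, rfl⟩
  | cons b p =>
    simp only [cons_append, cons.injEq] at h1
    obtain ⟨rfl, rfl⟩ := h1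
    cases q with
    | nil =>
      simp only [nil_append, cons.injEq] at h2
      obtain ⟨rfl, rfl⟩ := h2
      left
      rw [append_nil] at hv hn' ⊢
      have := rot_head hn' hv
      simp only [cons.injEq, Option.some.injEq] at this
      obtain ⟨rfl, rfl⟩ := this
      exact ⟨s, v', rfl, rfl, rfl⟩
    | cons c q =>
      simp only [cons_append, cons.injEq] at h2
      obtain ⟨rfl, h2⟩ := h2
      right
      have h3 : (none :: (q ++ a :: some (s + 1) :: p)) ~r (none :: some r :: A) := by
        refine IsRotated.trans ?_ hv
        have := isRotated_append (l := none :: q) (l' := a :: some (s + 1) :: p)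
        simpa using this
      have h4 := rot_head (h3.nodup_iff.2 hn) h3
      cases q with
      | nil =>
        simp only [nil_append, cons.injEq] at h2 h4
        obtain ⟨rfl, rfl⟩ := h2
        obtain ⟨h4, rfl⟩ := h4
        simp only [Option.some.injEq] at h4
        subst h4
        exact ⟨[], _, rfl, by simp⟩
      | cons d q =>
        simp only [cons_append, cons.injEq] at h2 h4
        obtain ⟨rfl, rfl⟩ := h2
        obtain ⟨h4, rfl⟩ := h4
        simp only [Option.some.injEq] at h4
        subst h4
        exact ⟨q ++ [a], p, by simp, by simp⟩

def Conn {m : ℕ} (c : List (Option (ZMod m))) : Prop := ∀ v, v ~r c → E v c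

theorem Conn.two {m : ℕ} {c u v : List (Option (ZMod m))} (h : Conn c) (hu : u ~r c)
    (hv : v ~r c) : E u v := (h u hu).trans (h v hv).symm

theorem conn_of {m : ℕ} {c o : List (Option (ZMod m))} (hc : Word c) (ho : o ~r c)
    (h : ∀ v, v ~r c → v ≠ o → E v (v.rotate 1)) : Conn c := by
  have hw : Word (o.rotate 1) := hc.rot (IsRotated.trans (IsRotated.forall _ _) ho)
  have key : ∀ k, k ≤ m → E (o.rotate 1) ((o.rotate 1).rotate k) := by
    intro k
    induction k with
    | zero => intro _; simpa using E.refl _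
    | succ k ih =>
      intro hk
      refine (ih (by omega)).trans ?_
      have := h ((o.rotate 1).rotate k)
        (((IsRotated.forall _ _).trans (IsRotated.forall _ _)).trans ho) ?_
      · rwa [rotate_rotate _ k 1] at this
      · intro he
        rw [rotate_rotate] at he
        have ho' := hc.rot ho
        have := (ho'.1.rotate_eq_self_iff).1 he
        rcases this with h1 | h1
        · rw [ho'.2] at h1
          rw [Nat.mod_eq_of_lt (by omega)] at h1
          omega
        · have := ho'.2; simp [h1] at this
  have all : ∀ v, v ~r c → E (o.rotate 1) v := by
    intro v hv
    have : (o.rotate 1) ~r v := ((IsRotated.forall _ _).trans ho).trans hv.symm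
    obtain ⟨k, rfl⟩ := this
    rw [← rotate_mod _ k]
    apply key
    rw [hw.2]
    have := Nat.mod_lt k (show 0 < m + 1 by omega)
    omega
  intro v hv
  exact (all v hv).symm.trans (all c (IsRotated.refl _))

theorem T1 {m : ℕ} (r : ZMod m) (l) (A B : List (Option (ZMod m))) :
    T (l :: some (r + 1) :: (A ++ none :: some r :: B)) :=
  ⟨l, _, r, B ++ l :: A, rfl, by
    have := isRotated_append (l := l :: A) (l' := none :: some r :: B)
    simpa using this⟩

theorem T2 {m : ℕ} (r : ZMod m) (A : List (Option (ZMod m))) :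
    T (some r :: some (r + 1) :: (A ++ [none])) :=
  ⟨some r, _, r, A, rfl, by
    have := isRotated_append (l := some r :: A) (l' := [none])
    simpa using this⟩

theorem T3 {m : ℕ} (r : ZMod m) (A : List (Option (ZMod m))) :
    T (none :: some (r + 1) :: some r :: A) :=
  ⟨none, _, r, A, rfl, IsRotated.refl _⟩

theorem chain {m : ℕ} (r : ZMod m) (A : List (Option (ZMod m))) :
    ∀ A1 A2, A1 ++ A2 = A →
    (∀ B1 B2, B1 ++ B2 = A → B1.length ≤ A1.length →
      Conn (none :: some r :: (B1 ++ some (r + 1) :: B2))) →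
    E (some (r + 1) :: (A2 ++ none :: some r :: A1)) (some (r + 1) :: some r :: (A ++ [none])) := by
  intro A1
  induction A1 using List.reverseRecOn with
  | nil =>
    intro A2 hA hC
    simp only [nil_append] at hA
    subst hA
    refine E.trans (Conn.two (hC [] A2 rfl le_rfl) ?_ ?_) (E.tau (T2 r A2))
    · have := isRotated_append (l := some (r + 1) :: A2) (l' := none :: some r :: [])
      simpa using this
    · have := isRotated_append (l := some r :: some (r + 1) :: A2) (l' := [none])
      simpa using this
  | append_singleton A1 l ih =>
    intro A2 hA hC
    refine E.trans (Conn.two (hC (A1 ++ [l]) A2 hA le_rfl) ?_ ?_)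
      (E.trans (E.tau (T1 r l A2 A1)) (ih (l :: A2) (by simpa using hA) ?_))
    · have := isRotated_append (l := some (r + 1) :: A2) (l' := none :: some r :: (A1 ++ [l]))
      simpa using this
    · have := isRotated_append (l := l :: some (r + 1) :: A2) (l' := none :: some r :: A1)
      simpa using this
    · intro B1 B2 hB hl
      exact hC B1 B2 hB (by simp; omega)

def D {m : ℕ} : ℕ → ZMod m → List (Option (ZMod m))
  | 0, _ => []
  | k + 1, r => some r :: D k (r - 1)

theorem D_length {m : ℕ} (k : ℕ) (r : ZMod m) : (D k r).length = k := by
  induction k generalizing r with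
  | zero => rfl
  | succ k ih => simp [D, ih]

theorem D_snoc {m : ℕ} (k : ℕ) (r : ZMod m) : D (k + 1) r = D k r ++ [some (r - k)] := by
  induction k generalizing r with
  | zero => simp [D]
  | succ k ih =>
    rw [D, ih, D]; simp only [cons_append, Nat.cast_add, Nat.cast_one]
    rw [show r - 1 - (k : ZMod m) = r - (k + 1) by ring]

theorem D_mem {m : ℕ} (k : ℕ) (r x : ZMod m) : some x ∈ D k r ↔ ∃ i < k, x = r - (i : ℕ) := by
  induction k with
  | zero => simp [D]
  | succ k ih =>
    rw [D_snoc, mem_append, ih]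
    simp only [mem_singleton, Option.some.injEq]
    constructor
    · rintro (⟨i, h, e⟩ | e)
      · exact ⟨i, by omega, e⟩
      · exact ⟨k, by omega, e⟩
    · rintro ⟨i, h, e⟩
      rcases Nat.lt_succ_iff_lt_or_eq.1 h with h | rfl
      · exact Or.inl ⟨i, h, e⟩
      · exact Or.inr e

theorem D_notMem {m : ℕ} (k : ℕ) (hk : k + 1 ≤ m) (r : ZMod m) : some (r + 1) ∉ D k r := by
  rw [D_mem]
  rintro ⟨i, h, e⟩
  have : ((i + 1 : ℕ) : ZMod m) = 0 := by
    push_cast; linear_combination e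
  rw [ZMod.natCast_eq_zero_iff] at this
  have := Nat.le_of_dvd (by omega) this
  omega

/-- If the run avoids `y`, it is inside the part before `y`. -/
theorem run_inside {α : Type*} {X Y Dk B : List α} {y : α} (h : X ++ y :: Y = Dk ++ B)
    (hy : y ∉ Dk) : ∃ Z, X = Dk ++ Z := by
  rw [append_eq_append_iff] at h
  rcases h with ⟨a, h1, h2⟩ | ⟨c, h1, h2⟩
  · cases a with
    | nil => exact ⟨[], by simp_all⟩
    | cons b a =>
      simp only [cons_append, cons.injEq] at h2
      exfalso; apply hy; rw [h1, h2.1]; simp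
  · exact ⟨c, h1⟩

def Run {m : ℕ} (k : ℕ) (c : List (Option (ZMod m))) : Prop := ∃ r B, c = none :: (D k r ++ B)

/-- every word beginning with `none` has the standard shape -/
theorem shape {m : ℕ} [NeZero m] (hm : 2 ≤ m) {L : List (Option (ZMod m))} (hc : Word (none :: L)) :
    ∃ r A1 A2, L = some r :: (A1 ++ some (r + 1) :: A2) := by
  cases L with
  | nil => have := hc.2; simp at this; omega
  | cons a L =>
    cases a with
    | none => have := hc.1; simp at this
    | some r =>
      have := hc.mem (some (r + 1))
      have h1 : some (r + 1) ∈ L := by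
        have h0 := D_notMem 1 (by omega) r
        simp only [D, mem_singleton] at h0
        simpa [mem_cons, h0] using this
      obtain ⟨A1, A2, rfl⟩ := append_of_mem h1
      exact ⟨r, A1, A2, rfl⟩

theorem perm_move {m : ℕ} {r : ZMod m} {A B1 B2 : List (Option (ZMod m))} (h : B1 ++ B2 = A)
    (hw : Word (none :: some (r + 1) :: some r :: A)) :
    Word (none :: some r :: (B1 ++ some (r + 1) :: B2)) := by
  subst h
  have hp : (none :: some r :: (B1 ++ some (r + 1) :: B2)) ~
      (none :: some (r + 1) :: some r :: (B1 ++ B2)) := by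
    refine Perm.cons _ ?_
    refine (Perm.cons _ perm_middle).trans (Perm.swap _ _ _)
  exact ⟨hp.nodup_iff.2 hw.1, by rw [hp.length_eq]; exact hw.2⟩

theorem perm_move' {m : ℕ} {r : ZMod m} {B1 B2 : List (Option (ZMod m))} 
    (hw : Word (none :: some r :: (B1 ++ some (r + 1) :: B2))) :
    Word (none :: some (r + 1) :: some r :: (B1 ++ B2)) := by
  have hp : (none :: some r :: (B1 ++ some (r + 1) :: B2)) ~
      (none :: some (r + 1) :: some r :: (B1 ++ B2)) := by
    refine Perm.cons _ ?_
    refine (Perm.cons _ perm_middle).trans (Perm.swap _ _ _)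
  exact ⟨hp.nodup_iff.1 hw.1, by rw [← hp.length_eq]; exact hw.2⟩

theorem conn_nonspecial_aux {m : ℕ} [NeZero m] (hm : 2 ≤ m) : ∀ k, k + 2 ≤ m →
    ∀ L : List (Option (ZMod m)), Word (none :: L) → ¬ Run (k + 1) (none :: L) →
      Conn (none :: L) := by
  intro k
  induction k with
  | zero =>
    intro _ L hL hR
    obtain ⟨r, A1, A2, rfl⟩ := shape hm hL
    exact absurd ⟨r, A1 ++ some (r + 1) :: A2, by simp [D]⟩ hR
  | succ k ih =>
    intro hk L hL hR
    obtain ⟨x, A1, A2, rfl⟩ := shape hm hL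
    have hor : (some (x + 1) :: (A2 ++ none :: some x :: A1)) ~r
        (none :: some x :: (A1 ++ some (x + 1) :: A2)) := by
      have := isRotated_append (l := some (x + 1) :: A2) (l' := none :: some x :: A1)
      simpa using this
    obtain ⟨j, hj⟩ := hor.symm
    obtain ⟨o, ho, hoc⟩ : ∃ o, o.rotate 1 = (some (x + 1) :: (A2 ++ none :: some x :: A1)) ∧
        o ~r (none :: some x :: (A1 ++ some (x + 1) :: A2)) := by
      refine ⟨(some (x + 1) :: (A2 ++ none :: some x :: A1)).rotate m, ?_, ?_⟩
      · rw [rotate_rotate, ← (hL.rot hor).2, rotate_length]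
      · exact (IsRotated.forall _ _).trans hor
    refine conn_of (o := o) hL hoc ?_
    intro v hv hvo
    by_cases hT : T v
    · rcases T_cases hL.1 hv hT with ⟨r, A', rfl, hA, rfl⟩ | ⟨B1, B2, hB, hr⟩
      · rw [hA] at hL hR ⊢
        refine (E.tau (T3 r A')).trans ?_
        have := chain r A' A' [] (by simp) ?_
        · simpa using this
        · intro B1 B2 hB hl
          apply ih (by omega) _ (perm_move hB hL)
          rintro ⟨r', B, he⟩
          apply hR
          simp only [D, cons_append, cons.injEq, Option.some.injEq, true_and] at he
          obtain ⟨rfl, he⟩ := he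
          have hnm := D_notMem (k + 1) (by omega) r
          obtain ⟨Z, hZ⟩ := run_inside (y := some (r + 1)) he (fun h => hnm (by simp [D, h]))
          refine ⟨r + 1, Z ++ B2, ?_⟩
          rw [← hB, hZ]; simp [D]
      · exfalso
        apply hvo
        have hn := hL.1
        have : A1 = B1 ∧ A2 = B2 := by
          have hn1 : (A1 ++ some (x + 1) :: A2).Nodup := by
            simp only [nodup_cons] at hn; exact hn.2.2
          have h1 : some (x + 1) ∉ A1 := by
            intro h
            rw [nodup_append] at hn1
            exact hn1.2.2 _ h _ (by simp) rfl
          have hn2 := hn1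
          rw [hB] at hn2
          have h2 : some (x + 1) ∉ B1 := by
            intro h
            rw [nodup_append] at hn2
            exact hn2.2.2 _ h _ (by simp) rfl
          obtain ⟨Z, hZ⟩ := run_inside hB h2
          obtain ⟨Z', hZ'⟩ := run_inside hB.symm h1
          have hz : A1.length = B1.length := by
            have e1 := congrArg length hZ
            have e2 := congrArg length hZ'
            simp at e1 e2; omega
          have := append_inj hB hz
          simpa using this
        obtain ⟨rfl, rfl⟩ := this
        apply rotate_injective 1
        simp only [hr, ho]; simp
    · exact E.sig hT

/-- special words -/
def S {m : ℕ} (r : ZMod m) : List (Option (ZMod m)) := none :: D m r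

theorem D_full {m : ℕ} (k : ℕ) (hk : m = k + 2) (r : ZMod m) :
    D m r = some r :: (D k (r - 1) ++ [some (r + 1)]) := by
  have : ((k : ℕ) : ZMod m) + 2 = 0 := by
    have := ZMod.natCast_self m
    conv_lhs at this => rw [show ((m : ℕ) : ZMod m) = ((k + 2 : ℕ) : ZMod m) by rw [← hk]]
    simpa using this
  rw [show D m r = D (k + 1 + 1) r by rw [← hk], D, D_snoc]
  rw [show r - 1 - (k : ZMod m) = r + 1 by linear_combination - this]

theorem conn_nonspecial {m : ℕ} [NeZero m] (hm : 2 ≤ m) (L : List (Option (ZMod m)))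
    (hL : Word (none :: L)) (hS : ∀ r, none :: L ≠ S r) : Conn (none :: L) := by
  obtain ⟨k, rfl⟩ : ∃ k, m = k + 2 := ⟨m - 2, by omega⟩
  apply conn_nonspecial_aux hm k le_rfl L hL
  rintro ⟨r, B, he⟩
  apply hS r
  rw [he, S, D_full k rfl, D]
  rw [he] at hL
  have hmem := hL.mem (some (r + 1))
  have hnm := D_notMem (k + 1) (by omega) r
  have hB : B.length = 1 := by
    have := hL.2
    simp [D_length] at this; omega
  obtain ⟨b, rfl⟩ := length_eq_one_iff.1 hB
  simp only [mem_cons, mem_append, hnm] at hmem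
  simp at hmem
  rw [← hmem]; simp

theorem special_last {m : ℕ} (hm : 2 ≤ m) {r r' : ZMod m} {B1 B2 : List (Option (ZMod m))}
    (hw : Word (none :: some r :: (B1 ++ some (r + 1) :: B2)))
    (h : none :: some r :: (B1 ++ some (r + 1) :: B2) = S r') : r' = r ∧ B2 = [] := by
  obtain ⟨k, rfl⟩ : ∃ k, m = k + 2 := ⟨m - 2, by omega⟩
  rw [S, D_full k rfl] at h
  simp only [cons.injEq, Option.some.injEq, true_and] at h
  obtain ⟨rfl, h⟩ := h
  refine ⟨rfl, ?_⟩
  rcases eq_nil_or_concat B2 with h0 | ⟨C, c, rfl⟩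
  · exact h0
  · exfalso
    have h' : (B1 ++ some (r + 1) :: C) ++ [c] = D k (r - 1) ++ [some (r + 1)] := by simpa using h
    have := (append_inj' h' rfl).2
    simp only [cons.injEq, and_true] at this
    subst this
    have := hw.1
    simp [nodup_append] at this

theorem D_nodup {m : ℕ} (k : ℕ) (hk : k ≤ m) (r : ZMod m) : (D k r).Nodup := by
  induction k with
  | zero => simp [D]
  | succ k ih =>
    rw [D_snoc, nodup_append]
    refine ⟨ih (by omega), by simp, ?_⟩
    rintro a ha b hb rfl
    simp only [mem_singleton] at hb
    subst hb
    obtain ⟨i, hi, e⟩ := (D_mem _ _ _).1 ha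
    have e' : ((k : ℕ) : ZMod m) = (i : ℕ) := by linear_combination - e
    rw [ZMod.natCast_eq_natCast_iff', Nat.mod_eq_of_lt (by omega), Nat.mod_eq_of_lt (by omega)] at e'
    omega

theorem none_notMem_D {m : ℕ} (k : ℕ) (r : ZMod m) : none ∉ D k r := by
  induction k generalizing r with
  | zero => simp [D]
  | succ k ih => simp [D, ih]

theorem S_word {m : ℕ} (r : ZMod m) : Word (S r) :=
  ⟨by rw [S, nodup_cons]; exact ⟨none_notMem_D _ _, D_nodup _ le_rfl _⟩, by simp [S, D_length]⟩

theorem S_eq {m : ℕ} (k : ℕ) (hk : m = k + 2) (r : ZMod m) :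
    S r = none :: some r :: (D k (r - 1) ++ [some (r + 1)]) := by
  rw [S, D_full k hk]

theorem S_eq' {m : ℕ} (k : ℕ) (hk : m = k + 2) (r : ZMod m) :
    S (r + 1) = none :: some (r + 1) :: some r :: D k (r - 1) := by
  rw [S, show D m (r + 1) = D (k + 1 + 1) (r + 1) by rw [← hk], D, D]
  simp

/-- Tau positions on a special cycle. -/
theorem S_T {m : ℕ} (hm : 2 ≤ m) (r : ZMod m) (v : List (Option (ZMod m))) (hv : v ~r S r)
    (hT : T v) : v = S r ∨ v.rotate 2 = S r := by
  obtain ⟨k, hk⟩ : ∃ k, m = k + 2 := ⟨m - 2, by omega⟩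
  have hw := S_word r
  have hS := S_eq k hk r
  rw [hS] at hv hw
  rcases T_cases hw.1 hv hT with ⟨r', A', _, _, h⟩ | ⟨B1, B2, hB, hr⟩
  · left; rw [h, hS]
  · right
    rw [hB] at hw
    have := (special_last (r' := r) hm hw (by rw [hS, hB])).2
    subst this
    rw [show v.rotate 2 = (v.rotate 1).rotate 1 by rw [rotate_rotate], hr, hS, hB]
    simp

theorem S_a {m : ℕ} (hm : 2 ≤ m) (r : ZMod m) :
    E (S (r + 1)) (S r) ∧ E ((S r).rotate m) (S r) := by
  obtain ⟨k, hk⟩ : ∃ k, m = k + 2 := ⟨m - 2, by omega⟩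
  have hw := S_word r
  have h1 : (some (r + 1) :: none :: some r :: D k (r - 1)).rotate 1 = S r := by
    rw [S_eq k hk r]; simp
  have h0 : (some (r + 1) :: none :: some r :: D k (r - 1)) = (S r).rotate m := by
    apply rotate_injective 1
    simp only
    rw [rotate_rotate, ← hw.2, rotate_length, h1]
  have h2 : E (some (r + 1) :: none :: some r :: D k (r - 1)) (S r) := by
    rw [← h1]
    apply E.sig
    intro hT
    rcases S_T hm r _ (by rw [h0]; exact IsRotated.forall _ _) hT with h | h
    · simp [S] at h
    · rw [show (2 : ℕ) = 1 + 1 from rfl, ← rotate_rotate, h1] at h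
      have := hw.1.rotate_eq_self_iff.1 h
      rw [hw.2, Nat.mod_eq_of_lt (by omega)] at this
      simp [S] at this
  refine ⟨?_, by rw [← h0]; exact h2⟩
  rw [S_eq' k hk r]
  exact (E.tau (T3 r _)).trans h2

theorem S_seg {m : ℕ} (hm : 2 ≤ m) (r : ZMod m) (j : ℕ) (h1 : 1 ≤ j) (hj : j + 1 ≤ m) :
    E ((S r).rotate 1) ((S r).rotate j) := by
  have hw := S_word r
  induction j, h1 using Nat.le_induction with
  | base => exact E.refl _
  | succ j h1 ih =>
    refine (ih (by omega)).trans ?_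
    rw [← rotate_rotate]
    apply E.sig
    intro hT
    rcases S_T hm r _ (IsRotated.forall _ _) hT with h | h
    · have := hw.1.rotate_eq_self_iff.1 h
      rw [hw.2, Nat.mod_eq_of_lt (by omega)] at this
      simp [S] at this; omega
    · rw [rotate_rotate] at h
      have := hw.1.rotate_eq_self_iff.1 h
      rw [hw.2, Nat.mod_eq_of_lt (by omega)] at this
      simp [S] at this

theorem S_b {m : ℕ} [NeZero m] (hm : 3 ≤ m) (r : ZMod m) :
    E ((S r).rotate 1) ((S (r + 1)).rotate 1) := by
  obtain ⟨k, hk⟩ : ∃ k, m = k + 2 := ⟨m - 2, by omega⟩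
  refine (S_seg (by omega) r (m - 1) (by omega) (by omega)).trans ?_
  have hw := S_word r
  have hw' := S_word (r + 1)
  rw [S_eq' k hk r] at hw' ⊢
  have hA : D k (r - 1) ≠ [] := by
    intro h
    have := congrArg length h
    rw [D_length] at this; simp at this; omega
  rcases eq_nil_or_concat (D k (r - 1)) with h0 | ⟨A', l, hl⟩
  · exact absurd h0 hA
  have h1 : (S r).rotate (m - 1) = l :: some (r + 1) :: ([] ++ none :: some r :: A') := by
    apply rotate_injective 2
    simp only
    rw [rotate_rotate, show m - 1 + 2 = (S r).length by rw [hw.2]; omega, rotate_length,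
      S_eq k hk r, hl]
    simp
  rw [h1]
  refine (E.tau (T1 r l [] A')).trans ?_
  have := chain r (D k (r - 1)) A' [l] (by simp [hl]) ?_
  · simpa using this
  · intro B1 B2 hB hlen
    have hwd := perm_move hB hw'
    apply conn_nonspecial (by omega) _ hwd
    intro r' he
    have := (special_last (by omega) hwd he).2
    subst this
    have e1 := congrArg length hB
    have e2 := congrArg length hl
    simp at e1 e2
    omega

theorem S_a0 {m : ℕ} [NeZero m] (hm : 3 ≤ m) (r : ZMod m) : E (S r) (S 0) := by
  have : ∀ k : ℕ, E (S (k : ZMod m)) (S 0) := by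
    intro k
    induction k with
    | zero => simpa using E.refl _
    | succ k ih =>
      push_cast
      exact (S_a (by omega) _).1.trans ih
  simpa using this r.val

theorem S_b0 {m : ℕ} [NeZero m] (hm : 3 ≤ m) (r : ZMod m) :
    E ((S r).rotate 1) ((S (0 : ZMod m)).rotate 1) := by
  have : ∀ k : ℕ, E ((S (k : ZMod m)).rotate 1) ((S (0 : ZMod m)).rotate 1) := by
    intro k
    induction k with
    | zero => rw [Nat.cast_zero]; exact E.refl _
    | succ k ih =>
      push_cast
      exact (S_b hm _).symm.trans ih
  simpa using this r.val

def Good {m : ℕ} (v : List (Option (ZMod m))) : Prop :=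
  E v (S 0) ∨ E v ((S (0 : ZMod m)).rotate 1)

theorem S_good {m : ℕ} [NeZero m] (hm : 3 ≤ m) (r : ZMod m) (v) (hv : v ~r S r) : Good v := by
  obtain ⟨j, rfl⟩ := hv.symm
  have hw := S_word r
  rw [← rotate_mod, hw.2]
  have := Nat.mod_lt j (show 0 < m + 1 by omega)
  generalize j % (m + 1) = i at this
  rcases Nat.eq_zero_or_pos i with rfl | hi
  · left; simpa using S_a0 hm r
  · by_cases him : i = m
    · subst him
      left
      exact (S_a (by omega) r).2.trans (S_a0 hm r)
    · right
      exact (S_seg (by omega) r i hi (by omega)).symm.trans (S_b0 hm r)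

theorem climb {m : ℕ} [NeZero m] (hm : 3 ≤ m) : ∀ j k, k + j = m → 1 ≤ k →
    ∀ L : List (Option (ZMod m)), Word (none :: L) → Run k (none :: L) →
      ∀ v, v ~r (none :: L) → Good v := by
  intro j
  induction j with
  | zero =>
    intro k hk hk1 L hL ⟨r, B, he⟩ v hv
    have hkm : k = m := by omega
    subst hkm
    have : B = [] := by
      have := hL.2
      rw [he] at this
      simp [D_length] at this
      exact this
    subst this
    rw [append_nil] at he
    exact S_good hm r v (by rw [he] at hv; exact hv)
  | succ j ih =>
    intro k hk hk1 L hL hR v hv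
    by_cases hS : ∃ r, none :: L = S r
    · obtain ⟨r, hr⟩ := hS
      exact S_good hm r v (by rw [hr] at hv; exact hv)
    push Not at hS
    have hC := conn_nonspecial (by omega) L hL hS
    obtain ⟨r, A1, A2, rfl⟩ := shape (by omega) hL
    have hE : E v (some (r + 1) :: some r :: ((A1 ++ A2) ++ [none])) := by
      refine E.trans (v := some (r + 1) :: (A2 ++ none :: some r :: A1)) (hC.two hv ?_) ?_
      · have := isRotated_append (l := some (r + 1) :: A2) (l' := none :: some r :: A1)
        simpa using this
      · apply chain r (A1 ++ A2) A1 A2 rfl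
        intro B1 B2 hB hlen
        have hwd := perm_move hB (perm_move' hL)
        apply conn_nonspecial (by omega) _ hwd
        intro r' he
        obtain ⟨rfl, rfl⟩ := special_last (by omega) hwd he
        have e1 := congrArg length hB
        simp at e1
        have : A2 = [] := by
          apply length_eq_zero_iff.1; omega
        subst this
        simp only [append_nil] at hB
        subst hB
        exact hS _ he
    have hg : Good (some (r + 1) :: some r :: ((A1 ++ A2) ++ [none])) := by
      apply ih (k + 1) (by omega) (by omega) (some (r + 1) :: some r :: (A1 ++ A2)) (perm_move' hL)
      · obtain ⟨r', B, he⟩ := hR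
        obtain ⟨k, rfl⟩ : ∃ k', k = k' + 1 := ⟨k - 1, by omega⟩
        simp only [D, cons_append, cons.injEq, Option.some.injEq, true_and] at he
        obtain ⟨rfl, he⟩ := he
        have hnm := D_notMem (k + 1) (by omega) r
        obtain ⟨Z, hZ⟩ := run_inside (y := some (r + 1)) he (fun h => hnm (by simp [D, h]))
        refine ⟨r + 1, Z ++ A2, ?_⟩
        rw [hZ]; simp [D]
      · have := isRotated_append (l := some (r + 1) :: some r :: (A1 ++ A2)) (l' := [none])
        simpa using this
    rcases hg with h | h
    · exact Or.inl (hE.trans h)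
    · exact Or.inr (hE.trans h)

theorem all_good {m : ℕ} [NeZero m] (hm : 3 ≤ m) (v : List (Option (ZMod m))) (hv : Word v) :
    Good v := by
  obtain ⟨p, q, rfl⟩ := append_of_mem (hv.mem none)
  have hr : (p ++ none :: q) ~r (none :: (q ++ p)) := by
    have := isRotated_append (l := p) (l' := none :: q)
    simpa using this
  have hw := hv.rot hr.symm
  refine climb hm (m - 1) 1 (by omega) le_rfl _ hw ?_ _ hr
  obtain ⟨r, A1, A2, h⟩ := shape (by omega) hw
  exact ⟨r, A1 ++ some (r + 1) :: A2, by rw [h]; simp [D]⟩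

theorem T_pred {m : ℕ} {a x} {l u : List (Option (ZMod m))} (h : T (a :: x :: l))
    (hu : u.rotate 1 = x :: a :: l) : T u := by
  rcases eq_nil_or_concat l with rfl | ⟨l', y, rfl⟩
  · have : u = [a, x] := by
      apply rotate_injective 1
      simp only [hu]; simp
    rw [this]; exact h
  · have : u = y :: x :: a :: l' := by
      apply rotate_injective 1
      simp only [hu]; simp
    subst this
    obtain ⟨a', l2, r, v, he, hr⟩ := h
    simp only [cons.injEq] at he
    obtain ⟨rfl, rfl, rfl⟩ := he
    refine ⟨y, a :: l', r, v, rfl, IsRotated.trans ?_ hr⟩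
    have := isRotated_append (l := [y]) (l' := a :: l')
    simpa using this

noncomputable def phi (m : ℕ) [NeZero m] : Fin (m + 1) ≃ Option (ZMod m) :=
  Fintype.equivOfCardEq (by simp [ZMod.card])

noncomputable def W {m : ℕ} [NeZero m] (π : Equiv.Perm (Fin (m + 1))) : List (Option (ZMod m)) :=
  List.ofFn (fun i => phi m (π i))

theorem W_word {m : ℕ} [NeZero m] (π : Equiv.Perm (Fin (m + 1))) : Word (W π) :=
  ⟨List.nodup_ofFn.2 ((phi m).injective.comp π.injective), by simp [W]⟩

theorem W_inj {m : ℕ} [NeZero m] : Function.Injective (W (m := m)) := by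
  intro π π' h
  have := List.ofFn_injective h
  ext i
  have := congrFun this i
  simp at this
  rw [this]

theorem W_surj {m : ℕ} [NeZero m] (w : List (Option (ZMod m))) (hw : Word w) : ∃ π, W π = w := by
  have hinj : Function.Injective (fun i : Fin (m + 1) => (phi m).symm (w.get (i.cast hw.2.symm))) := by
    intro i j h
    have := hw.1.injective_get ((phi m).symm.injective h)
    simpa using this
  refine ⟨Equiv.ofBijective _ (Finite.injective_iff_bijective.1 hinj), ?_⟩
  apply List.ext_getElem
  · simp [W, hw.2]
  · intro i h1 h2
    simp only [W, List.getElem_ofFn]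
    simp

theorem W_sig {m : ℕ} [NeZero m] (π : Equiv.Perm (Fin (m + 1))) :
    W (π * finRotate (m + 1)) = (W π).rotate 1 := by
  apply List.ext_getElem
  · simp [W]
  · intro i h1 h2
    rw [List.getElem_rotate]
    simp only [W, List.getElem_ofFn, Equiv.Perm.mul_apply, finRotate_apply, List.length_ofFn]
    congr 2
    ext
    simp [Fin.val_add]

theorem W_tau {m : ℕ} [NeZero m] (π : Equiv.Perm (Fin (m + 1))) (h0 : 0 < m + 1) (h1 : 1 < m + 1) :
    ∃ a b l, W π = a :: b :: l ∧ W (π * Equiv.swap ⟨0, h0⟩ ⟨1, h1⟩) = b :: a :: l := by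
  obtain ⟨k, rfl⟩ : ∃ k, m = k + 1 := ⟨m - 1, by omega⟩
  refine ⟨_, _, _, by rw [W, List.ofFn_succ, List.ofFn_succ], ?_⟩
  rw [W, List.ofFn_succ, List.ofFn_succ]
  have e0 : (⟨0, h0⟩ : Fin (k + 1 + 1)) = 0 := rfl
  have e1 : (⟨1, h1⟩ : Fin (k + 1 + 1)) = Fin.succ 0 := rfl
  rw [e0, e1]
  congr 1

open Classical in
/-- The abstract gluing argument: at most two cycles plus a connected graph gives a path. -/
theorem glue {G : Type*} [Group G] [Fintype G] (s t : G) (hs : s ≠ 1) (ht : t ≠ 1)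
    (hgen : Subgroup.closure {s, t} = ⊤) (F : Equiv.Perm G) (hF : ∀ g, F g = g * s ∨ F g = g * t)
    (a b : G) (hab : ∀ g, F.SameCycle g a ∨ F.SameCycle g b) :
    ∃ l : List G, l.Nodup ∧ (∀ g, g ∈ l) ∧ l.IsChain (fun x y => y = x * s ∨ y = x * t) := by
  have hsupp : ∀ g, g ∈ F.support := by
    intro g
    rw [Equiv.Perm.mem_support]
    rcases hF g with h | h <;> rw [h] <;> simpa
  have hchain : ∀ g, (F.toList g).IsChain (fun x y => y = x * s ∨ y = x * t) := by
    intro g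
    rw [List.isChain_iff_getElem]
    intro i hi
    rw [Equiv.Perm.getElem_toList, Equiv.Perm.getElem_toList, pow_succ', Equiv.Perm.mul_apply]
    exact hF _
  have hmem : ∀ g x, x ∈ F.toList g ↔ F.SameCycle g x := by
    intro g x
    rw [Equiv.Perm.mem_toList_iff]; simp [hsupp]
  by_cases hsc : F.SameCycle a b
  · refine ⟨F.toList a, Equiv.Perm.nodup_toList _ _, ?_, hchain a⟩
    intro g
    rw [hmem]
    rcases hab g with h | h
    · exact h.symm
    · exact hsc.trans h.symm
  · -- a crossing edge
    obtain ⟨u, hu, u', hu', hb⟩ : ∃ u, F.SameCycle u a ∧ ∃ u', (u' = u * s ∨ u' = u * t) ∧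
        F.SameCycle u' b := by
      by_contra hcon
      push Not at hcon
      have hclosed : ∀ u, F.SameCycle u a → F.SameCycle (u * s) a ∧ F.SameCycle (u * t) a := by
        intro u hu
        exact ⟨(hab _).resolve_right (hcon u hu _ (Or.inl rfl)),
          (hab _).resolve_right (hcon u hu _ (Or.inr rfl))⟩
      have hall : ∀ g : G, ∀ u, F.SameCycle u a → F.SameCycle (u * g) a := by
        intro g
        have hg : g ∈ Submonoid.closure {s, t} := by
          have : g ∈ Subgroup.closure {s, t} := by rw [hgen]; trivial
          rwa [← Subgroup.mem_toSubmonoid, Subgroup.closure_toSubmonoid_of_finite] at this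
        induction hg using Submonoid.closure_induction with
        | mem x hx =>
          intro u hu
          rcases hx with rfl | hx
          · exact (hclosed u hu).1
          · rw [Set.mem_singleton_iff] at hx; subst hx; exact (hclosed u hu).2
        | one => intro u hu; simpa using hu
        | mul x y _ _ hx hy => intro u hu; rw [← mul_assoc]; exact hy _ (hx _ hu)
      apply hsc
      have := hall (a⁻¹ * b) a (Equiv.Perm.SameCycle.refl _ _)
      simpa using this.symm
    refine ⟨F.toList (F u) ++ F.toList u', ?_, ?_, ?_⟩
    · rw [List.nodup_append]
      refine ⟨Equiv.Perm.nodup_toList _ _, Equiv.Perm.nodup_toList _ _, ?_⟩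
      rintro x hx y hy rfl
      rw [hmem] at hx hy
      apply hsc
      have h1 : F.SameCycle u x := by simpa using hx
      exact hu.symm.trans (h1.trans (hy.symm.trans hb))
    · intro g
      rw [List.mem_append, hmem, hmem]
      rcases hab g with h | h
      · left
        have : F.SameCycle u g := hu.trans h.symm
        simpa using this
      · right
        exact hb.trans h.symm
    · rw [List.isChain_append]
      refine ⟨hchain _, hchain _, ?_⟩
      intro x hx y hy
      have hy' : y = u' := by
        have hpos := Equiv.Perm.length_toList_pos_of_mem_support F u' (hsupp u')
        rw [List.head?_eq_getElem?, List.getElem?_eq_getElem hpos] at hy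
        simp [Equiv.Perm.getElem_toList] at hy
        exact hy.symm
      have hx' : x = u := by
        have hpos := Equiv.Perm.length_toList_pos_of_mem_support F (F u) (hsupp _)
        rw [List.getLast?_eq_getElem?, List.getElem?_eq_getElem (by omega)] at hx
        simp only [Equiv.Perm.getElem_toList, Option.mem_def, Option.some.injEq] at hx
        rw [← hx, ← Equiv.Perm.mul_apply, ← pow_succ, Nat.sub_add_cancel hpos,
          Equiv.Perm.length_toList]
        have h1 : F.SameCycle (F u) u := by simpa using Equiv.Perm.SameCycle.refl F u
        rw [h1.cycleOf_eq]
        rw [← (Equiv.Perm.isCycle_cycleOf F (Equiv.Perm.mem_support.1 (hsupp u))).orderOf]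
        rw [← Equiv.Perm.cycleOf_pow_apply_self, pow_orderOf_eq_one]; rfl
      subst hx' hy'
      exact hu'

open Classical in
theorem main {m : ℕ} [NeZero m] (hm : 3 ≤ m) (h0 : 0 < m + 1) (h1 : 1 < m + 1) :
    ∃ l : List (Equiv.Perm (Fin (m + 1))),
      l.Nodup ∧ (∀ π : Equiv.Perm (Fin (m + 1)), π ∈ l) ∧
      l.IsChain (fun a b =>
        b = a * finRotate (m + 1) ∨ b = a * Equiv.swap ⟨0, h0⟩ ⟨1, h1⟩) := by
  set s := finRotate (m + 1) with hs
  set t : Equiv.Perm (Fin (m + 1)) := Equiv.swap ⟨0, h0⟩ ⟨1, h1⟩ with ht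
  let F0 : Equiv.Perm (Fin (m + 1)) → Equiv.Perm (Fin (m + 1)) :=
    fun π => if T (W π) then π * t else π * s
  have key : ∀ π π' : Equiv.Perm (Fin (m + 1)), T (W π) → π * t = π' * s → T (W π') := by
    intro π π' hT he
    obtain ⟨a, b, l, e1, e2⟩ := W_tau π h0 h1
    rw [e1] at hT
    refine T_pred hT ?_
    rw [← W_sig, ← hs, ← he, e2]
  have hinj : Function.Injective F0 := by
    intro π π' h
    simp only [F0] at h
    split_ifs at h with h2 h3 h3
    · exact mul_right_cancel h
    · exact absurd (key _ _ h2 h) h3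
    · exact absurd (key _ _ h3 h.symm) h2
    · exact mul_right_cancel h
  let F : Equiv.Perm (Equiv.Perm (Fin (m + 1))) :=
    Equiv.ofBijective F0 (Finite.injective_iff_bijective.1 hinj)
  have hFdef : ∀ π, F π = if T (W π) then π * t else π * s := fun π => rfl
  have hstep : ∀ w w', Step w w' → (∀ π, W π = w → W (F π) = w') ∧
      (Word w' → Word w) := by
    intro w w' h
    cases h with
    | sig w hT =>
      refine ⟨?_, fun h => h.rot (IsRotated.forall w 1).symm⟩
      rintro π rfl
      rw [hFdef, if_neg hT, hs, W_sig]
    | tau a b l hT =>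
      refine ⟨?_, ?_⟩
      · intro π hπ
        rw [hFdef, if_pos (by rw [hπ]; exact hT)]
        obtain ⟨a', b', l', e1, e2⟩ := W_tau π h0 h1
        rw [e1] at hπ
        simp only [cons.injEq] at hπ
        obtain ⟨rfl, rfl, rfl⟩ := hπ
        exact e2
      · intro h
        have hp := Perm.swap a b l
        exact ⟨hp.nodup_iff.1 h.1, by rw [← hp.length_eq]; exact h.2⟩
  have hE : ∀ w w', E w w' → (∀ π, W π = w → ∃ π', W π' = w' ∧ F.SameCycle π π') ∧
      (∀ π', W π' = w' → ∃ π, W π = w ∧ F.SameCycle π π') := by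
    intro w w' h
    induction h with
    | rel x y h =>
      refine ⟨fun π hπ => ⟨F π, (hstep _ _ h).1 π hπ, by simpa using Equiv.Perm.SameCycle.refl F π⟩, ?_⟩
      intro π' hπ'
      obtain ⟨π, hπ⟩ := W_surj x ((hstep _ _ h).2 (hπ' ▸ W_word π'))
      refine ⟨π, hπ, ?_⟩
      have := (hstep _ _ h).1 π hπ
      have : F π = π' := W_inj (this.trans hπ'.symm)
      rw [← this]; simpa using Equiv.Perm.SameCycle.refl F π
    | refl x =>
      exact ⟨fun π h => ⟨π, h, Equiv.Perm.SameCycle.refl _ _⟩,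
        fun π h => ⟨π, h, Equiv.Perm.SameCycle.refl _ _⟩⟩
    | symm x y _ ih =>
      refine ⟨fun π h => ?_, fun π h => ?_⟩
      · obtain ⟨p, h1, h2⟩ := ih.2 π h
        exact ⟨p, h1, h2.symm⟩
      · obtain ⟨p, h1, h2⟩ := ih.1 π h
        exact ⟨p, h1, h2.symm⟩
    | trans x y z _ _ ih1 ih2 =>
      refine ⟨fun π h => ?_, fun π h => ?_⟩
      · obtain ⟨p, h1, h2⟩ := ih1.1 π h
        obtain ⟨q, h3, h4⟩ := ih2.1 p h1
        exact ⟨q, h3, h2.trans h4⟩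
      · obtain ⟨p, h1, h2⟩ := ih2.2 π h
        obtain ⟨q, h3, h4⟩ := ih1.2 p h1
        exact ⟨q, h3, h4.trans h2⟩
  obtain ⟨a, ha⟩ := W_surj _ (S_word (0 : ZMod m))
  obtain ⟨b, hb⟩ := W_surj _ ((S_word (0 : ZMod m)).rot (IsRotated.forall _ 1))
  obtain ⟨k, rfl⟩ : ∃ k, m = k + 1 := ⟨m - 1, by omega⟩
  refine glue s t ?_ ?_ ?_ F ?_ a b ?_
  · intro h
    have := congrArg (fun p => p 0) h
    simp [hs] at this
  · rw [ht, Ne, Equiv.swap_eq_one_iff]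
    simp
  · have := Equiv.Perm.closure_cycle_adjacent_swap (isCycle_finRotate (n := k))
      (support_finRotate) ⟨0, h0⟩
    rw [hs, ht]
    convert this using 4
    rw [finRotate_apply]
    ext
    simp [Fin.val_add]
  · intro g
    rw [hFdef]
    split_ifs
    · exact Or.inr rfl
    · exact Or.inl rfl
  · intro g
    rcases all_good hm _ (W_word g) with h | h
    · left
      obtain ⟨p, h1, h2⟩ := (hE _ _ h).1 g rfl
      rwa [← W_inj (h1.trans ha.symm)]
    · right
      obtain ⟨p, h1, h2⟩ := (hE _ _ h).1 g rfl
      rwa [← W_inj (h1.trans hb.symm)]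

end SigTau

/-- (Sawada–Williams) For every `n ≥ 2` there is an ordering `π₁, π₂, …, π_{n!}` of all
elements of `Sₙ`, without repetitions, in which each permutation is obtained from the
previous one by right multiplication by `σ = (1 2 … n)` (realized as `finRotate n`) or
by `τ = (1 2)`: the directed Cayley graph of `Sₙ` with generators `σ, τ` has a
Hamiltonian path. -/
theorem sigma_tau_hamiltonian_path (n : ℕ) (hn : 2 ≤ n) :
    ∃ l : List (Equiv.Perm (Fin n)),
      l.Nodup ∧ (∀ π : Equiv.Perm (Fin n), π ∈ l) ∧
      l.Chain' (fun a b =>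
        b = a * finRotate n ∨ b = a * Equiv.swap ⟨0, by omega⟩ ⟨1, by omega⟩) := by
  rcases Nat.lt_or_ge n 4 with h4 | h4
  · interval_cases n
    · refine ⟨[1, finRotate 2], ?_, ?_, ?_⟩
      · decide
      · decide
      · refine List.IsChain.cons_cons ?_ (List.IsChain.singleton _)
        left; simp
    · refine ⟨[1, finRotate 3, finRotate 3 * finRotate 3,
        finRotate 3 * finRotate 3 * Equiv.swap 0 1,
        finRotate 3 * finRotate 3 * Equiv.swap 0 1 * finRotate 3,
        finRotate 3 * finRotate 3 * Equiv.swap 0 1 * finRotate 3 * finRotate 3], ?_, ?_, ?_⟩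
      · decide
      · decide
      · exact .cons_cons (Or.inl (one_mul _).symm) (.cons_cons (Or.inl rfl) (.cons_cons (Or.inr rfl)
          (.cons_cons (Or.inl rfl) (.cons_cons (Or.inl rfl) (.singleton _)))))
  · obtain ⟨m, rfl⟩ : ∃ m, n = m + 1 := ⟨n - 1, by omega⟩
    have : NeZero m := ⟨by omega⟩
    exact SigTau.main (by omega) _ _
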